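/- Let T > 0 and let v_r, v_θ, ρ, p : [0,T] × [R₁,R₂] × ℝ → ℝ be 2π-periodic in θ, with v_r, v_θ continuous together with ∂_t v_r, ∂_t v_θ and all their spatial partial derivatives up to order two, ρ continuously differentiable, and p continuously differentiable in (r,θ). If (v_r, v_θ, ρ, p) solve the linearized problem on [0,T] and v_r(0,·,·) = v_θ(0,·,·) = ρ(0,·,·) = 0, then v_r ≡ 0, v_θ ≡ 0, ρ ≡ 0, and ∂_r p ≡ 0 and ∂_θ p ≡ 0 on [0,T] × [R₁,R₂] × ℝ. -/

import Mathlib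

open Real MeasureTheory Set

noncomputable section

/-- Partial derivative in time. -/
def dt3 (u : ℝ → ℝ → ℝ → ℝ) (t r θ : ℝ) : ℝ := deriv (fun t' => u t' r θ) t

/-- Partial derivative in the radial variable. -/
def dr3 (u : ℝ → ℝ → ℝ → ℝ) (t r θ : ℝ) : ℝ := deriv (fun r' => u t r' θ) r

/-- Partial derivative in the angular variable. -/
def dq3 (u : ℝ → ℝ → ℝ → ℝ) (t r θ : ℝ) : ℝ := deriv (fun θ' => u t r θ') θ

/-- The polar Laplacian `Δ_r u = ∂_rr u + (1/r) ∂_r u + (1/r²) ∂_θθ u`. -/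
def lapR (u : ℝ → ℝ → ℝ → ℝ) (t r θ : ℝ) : ℝ :=
  dr3 (dr3 u) t r θ + (1 / r) * dr3 u t r θ + (1 / r ^ 2) * dq3 (dq3 u) t r θ

/-- Uncurrying a function of `(t, r, θ)`. -/
def u3 (u : ℝ → ℝ → ℝ → ℝ) : ℝ × ℝ × ℝ → ℝ := fun x => u x.1 x.2.1 x.2.2

/-- The space-time domain `[0,T] × [R₁,R₂] × ℝ`. -/
def dom3 (T R₁ R₂ : ℝ) : Set (ℝ × ℝ × ℝ) :=
  Icc (0:ℝ) T ×ˢ (Icc R₁ R₂ ×ˢ (univ : Set ℝ))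

/-- `u` is continuous on `[0,T] × [R₁,R₂] × ℝ` together with `∂_t u` and all
spatial partial derivatives up to order two. -/
def Reg2 (T R₁ R₂ : ℝ) (u : ℝ → ℝ → ℝ → ℝ) : Prop :=
  (∀ t ∈ Icc (0:ℝ) T, ∀ r ∈ Icc R₁ R₂, ∀ θ : ℝ,
    DifferentiableAt ℝ (fun t' => u t' r θ) t ∧
    DifferentiableAt ℝ (fun r' => u t r' θ) r ∧
    DifferentiableAt ℝ (fun θ' => u t r θ') θ ∧
    DifferentiableAt ℝ (fun r' => dr3 u t r' θ) r ∧
    DifferentiableAt ℝ (fun θ' => dr3 u t r θ') θ ∧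
    DifferentiableAt ℝ (fun θ' => dq3 u t r θ') θ) ∧
  ContinuousOn (u3 u) (dom3 T R₁ R₂) ∧
  ContinuousOn (u3 (dt3 u)) (dom3 T R₁ R₂) ∧
  ContinuousOn (u3 (dr3 u)) (dom3 T R₁ R₂) ∧
  ContinuousOn (u3 (dq3 u)) (dom3 T R₁ R₂) ∧
  ContinuousOn (u3 (dr3 (dr3 u))) (dom3 T R₁ R₂) ∧
  ContinuousOn (u3 (dq3 (dr3 u))) (dom3 T R₁ R₂) ∧
  ContinuousOn (u3 (dq3 (dq3 u))) (dom3 T R₁ R₂)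

/-- `u` is continuously differentiable on `[0,T] × [R₁,R₂] × ℝ`. -/
def Reg1 (T R₁ R₂ : ℝ) (u : ℝ → ℝ → ℝ → ℝ) : Prop :=
  (∀ t ∈ Icc (0:ℝ) T, ∀ r ∈ Icc R₁ R₂, ∀ θ : ℝ,
    DifferentiableAt ℝ (fun t' => u t' r θ) t ∧
    DifferentiableAt ℝ (fun r' => u t r' θ) r ∧
    DifferentiableAt ℝ (fun θ' => u t r θ') θ) ∧
  ContinuousOn (u3 u) (dom3 T R₁ R₂) ∧
  ContinuousOn (u3 (dt3 u)) (dom3 T R₁ R₂) ∧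
  ContinuousOn (u3 (dr3 u)) (dom3 T R₁ R₂) ∧
  ContinuousOn (u3 (dq3 u)) (dom3 T R₁ R₂)

/-- `u` is continuously differentiable in the spatial variables `(r,θ)`. -/
def RegP (T R₁ R₂ : ℝ) (u : ℝ → ℝ → ℝ → ℝ) : Prop :=
  (∀ t ∈ Icc (0:ℝ) T, ∀ r ∈ Icc R₁ R₂, ∀ θ : ℝ,
    DifferentiableAt ℝ (fun r' => u t r' θ) r ∧
    DifferentiableAt ℝ (fun θ' => u t r θ') θ) ∧
  ContinuousOn (u3 u) (dom3 T R₁ R₂) ∧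
  ContinuousOn (u3 (dr3 u)) (dom3 T R₁ R₂) ∧
  ContinuousOn (u3 (dq3 u)) (dom3 T R₁ R₂)

/-- `(v_r, v_θ, ρ, p)` solves the linearized problem on `[0,T] × [R₁,R₂] × ℝ`. -/
def SolvesLinOn (T R₁ R₂ μ α g : ℝ) (ρb : ℝ → ℝ) (vr vθ ρ p : ℝ → ℝ → ℝ → ℝ) : Prop :=
  (∀ t ∈ Icc (0:ℝ) T, ∀ r ∈ Icc R₁ R₂, ∀ θ : ℝ,
    ρb r * dt3 vr t r θ =
      μ * (lapR vr t r θ - vr t r θ / r ^ 2 - (2 / r ^ 2) * dq3 vθ t r θ) -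
        dr3 p t r θ - ρ t r θ * g ∧
    ρb r * dt3 vθ t r θ =
      μ * (lapR vθ t r θ - vθ t r θ / r ^ 2 + (2 / r ^ 2) * dq3 vr t r θ) -
        (1 / r) * dq3 p t r θ ∧
    dt3 ρ t r θ = -(vr t r θ * deriv ρb r) ∧
    deriv (fun x => x * vr t x θ) r + dq3 vθ t r θ = 0) ∧
  (∀ t ∈ Icc (0:ℝ) T, ∀ θ : ℝ,
    vr t R₁ θ = 0 ∧ vr t R₂ θ = 0 ∧ vθ t R₂ θ = 0 ∧
    dr3 vθ t R₁ θ = (1 / R₁ - α / μ) * vθ t R₁ θ)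

/-- Fubini and the fundamental theorem of calculus in the first variable of a rectangle. -/
lemma setIntegral_prod_deriv_fst {a b c d : ℝ} (hab : a ≤ b) {f f' : ℝ → ℝ → ℝ}
    (hf : ∀ x ∈ Icc a b, ∀ y ∈ Icc c d, HasDerivAt (fun x' => f x' y) (f' x y) x)
    (hc : ContinuousOn (fun z : ℝ × ℝ => f' z.1 z.2) (Icc a b ×ˢ Icc c d)) :
    ∫ z in Icc a b ×ˢ Icc c d, f' z.1 z.2 = ∫ y in Icc c d, (f b y - f a y) := by
  have hi : IntegrableOn (fun z : ℝ × ℝ => f' z.1 z.2) (Icc a b ×ˢ Icc c d) :=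
    hc.integrableOn_compact (isCompact_Icc.prod isCompact_Icc)
  rw [Measure.volume_eq_prod] at hi ⊢
  rw [← Measure.prod_restrict, integral_prod_symm _ (by rwa [Measure.prod_restrict])]
  refine setIntegral_congr_fun measurableSet_Icc fun y hy => ?_
  have hcy : ContinuousOn (fun x => f' x y) (Icc a b) :=
    hc.comp (f := fun x => (x, y)) (by fun_prop) fun x hx => ⟨hx, hy⟩
  simp only
  rw [integral_Icc_eq_integral_Ioc, ← intervalIntegral.integral_of_le hab]
  refine intervalIntegral.integral_eq_sub_of_hasDerivAt (f := fun x => f x y) (fun x hx => ?_)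
    (ContinuousOn.intervalIntegrable ?_)
  · rw [uIcc_of_le hab] at hx
    exact hf x hx y hy
  · rwa [uIcc_of_le hab]

/-- Fubini and the fundamental theorem of calculus in the second variable of a rectangle. -/
lemma setIntegral_prod_deriv_snd {a b c d : ℝ} (hcd : c ≤ d) {f f' : ℝ → ℝ → ℝ}
    (hf : ∀ x ∈ Icc a b, ∀ y ∈ Icc c d, HasDerivAt (fun y' => f x y') (f' x y) y)
    (hc : ContinuousOn (fun z : ℝ × ℝ => f' z.1 z.2) (Icc a b ×ˢ Icc c d)) :
    ∫ z in Icc a b ×ˢ Icc c d, f' z.1 z.2 = ∫ x in Icc a b, (f x d - f x c) := by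
  rw [← setIntegral_prod_deriv_fst (f := fun y x => f x y) hcd (fun y hy x hx => hf x hx y hy)
    (hc.comp (f := Prod.swap) (by fun_prop) fun z hz => ⟨hz.2, hz.1⟩)]
  exact setIntegral_prod_swap (μ := volume) (ν := volume) (Icc c d) (Icc a b)
    fun z : ℝ × ℝ => f' z.2 z.1

/-- A parametric integral over a compact set is continuous, and differentiable in the interior. -/
lemma parametric_setIntegral {X : Type*} [TopologicalSpace X] [T2Space X]
    [SecondCountableTopology X] [MeasurableSpace X] [BorelSpace X] {ν : Measure X}
    [IsFiniteMeasureOnCompacts ν] {K : Set X} (hK : IsCompact K) {T : ℝ} {f f' : ℝ → X → ℝ}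
    (hf : ∀ t ∈ Icc 0 T, ∀ x ∈ K, HasDerivAt (fun s => f s x) (f' t x) t)
    (hc : ContinuousOn (fun z : ℝ × X => f z.1 z.2) (Icc 0 T ×ˢ K))
    (hc' : ContinuousOn (fun z : ℝ × X => f' z.1 z.2) (Icc 0 T ×ˢ K)) :
    ContinuousOn (fun t => ∫ x in K, f t x ∂ν) (Icc 0 T) ∧
    ∀ t ∈ Ioo 0 T, HasDerivAt (fun t => ∫ x in K, f t x ∂ν) (∫ x in K, f' t x ∂ν) t := by
  have hslice : ∀ {h : ℝ → X → ℝ}, ContinuousOn (fun z : ℝ × X => h z.1 z.2) (Icc 0 T ×ˢ K) →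
      ∀ t ∈ Icc 0 T, ContinuousOn (h t) K := fun {h} hh t ht =>
    hh.comp (f := fun x => (t, x)) (by fun_prop) fun x hx => ⟨ht, hx⟩
  have hmeas : ∀ {h : ℝ → X → ℝ}, ContinuousOn (fun z : ℝ × X => h z.1 z.2) (Icc 0 T ×ˢ K) →
      ∀ t ∈ Icc 0 T, IntegrableOn (h t) K ν := fun {h} hh t ht =>
    (hslice hh t ht).integrableOn_compact hK
  obtain ⟨B, hB⟩ := (isCompact_Icc.prod hK).exists_bound_of_continuousOn hc
  obtain ⟨B', hB'⟩ := (isCompact_Icc.prod hK).exists_bound_of_continuousOn hc'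
  have hconst : ∀ b : ℝ, Integrable (fun _ => b) (ν.restrict K) := fun b =>
    integrableOn_const hK.measure_lt_top.ne
  refine ⟨continuousOn_of_dominated (bound := fun _ => B) (fun t ht => (hmeas hc t ht).1)
    (fun t ht => ?_) (hconst B) ?_, fun t ht => ?_⟩
  · filter_upwards [ae_restrict_mem hK.measurableSet] with x hx using hB (t, x) ⟨ht, hx⟩
  · filter_upwards [ae_restrict_mem hK.measurableSet] with x hx
    exact hc.comp (f := fun t => (t, x)) (by fun_prop) fun t ht => ⟨ht, hx⟩
  · refine (hasDerivAt_integral_of_dominated_loc_of_deriv_le (bound := fun _ => B')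
      (Ioo_mem_nhds ht.1 ht.2) ?_ (hmeas hc t (Ioo_subset_Icc_self ht))
      (hmeas hc' t (Ioo_subset_Icc_self ht)).1 ?_ (hconst B') ?_).2
    · filter_upwards [Ioo_mem_nhds ht.1 ht.2] with s hs
      exact (hmeas hc s (Ioo_subset_Icc_self hs)).1
    · filter_upwards [ae_restrict_mem hK.measurableSet] with x hx s hs
      exact hB' (s, x) ⟨Ioo_subset_Icc_self hs, hx⟩
    · filter_upwards [ae_restrict_mem hK.measurableSet] with x hx s hs
      exact hf s (Ioo_subset_Icc_self hs) x hx

/-- Grönwall's inequality for a function starting at zero. -/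
lemma nonpos_of_deriv_le_mul {T C : ℝ} {E E' : ℝ → ℝ} (hc : ContinuousOn E (Icc 0 T))
    (hd : ∀ t ∈ Ioo 0 T, HasDerivAt E (E' t) t) (hle : ∀ t ∈ Ioo 0 T, E' t ≤ C * E t)
    (h0 : E 0 ≤ 0) {t : ℝ} (ht : t ∈ Icc 0 T) : E t ≤ 0 := by
  have hD : ∀ s ∈ Ioo 0 T, HasDerivAt (fun s => E s * exp (-(C * s)))
      (E' s * exp (-(C * s)) + E s * (exp (-(C * s)) * -(C * 1))) s := fun s hs =>
    (hd s hs).mul ((hasDerivAt_id' s).const_mul C).neg.exp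
  have hanti : AntitoneOn (fun s => E s * exp (-(C * s))) (Icc 0 T) := by
    refine antitoneOn_of_deriv_nonpos (convex_Icc 0 T) (hc.mul (by fun_prop)) ?_ ?_ <;>
      rw [interior_Icc]
    · exact fun s hs => (hD s hs).differentiableAt.differentiableWithinAt
    · intro s hs
      rw [(hD s hs).deriv]
      nlinarith [mul_le_mul_of_nonneg_right (hle s hs) (exp_pos (-(C * s))).le]
  have h := hanti (left_mem_Icc.2 (ht.1.trans ht.2)) ht ht.1
  simp only [mul_zero, neg_zero, exp_zero, mul_one] at h
  exact nonpos_of_mul_nonpos_left (h.trans h0) (exp_pos _)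

/-- A continuous nonnegative function with nonpositive integral over a rectangle vanishes there. -/
lemma eq_zero_of_setIntegral_rect_nonpos {a b c d : ℝ} (hab : a < b) (hcd : c < d)
    {f : ℝ × ℝ → ℝ} (hc : ContinuousOn f (Icc a b ×ˢ Icc c d))
    (h0 : ∀ z ∈ Icc a b ×ˢ Icc c d, 0 ≤ f z) (hi : ∫ z in Icc a b ×ˢ Icc c d, f z ≤ 0) :
    ∀ z ∈ Icc a b ×ˢ Icc c d, f z = 0 := by
  have hm : MeasurableSet (Icc a b ×ˢ Icc c d) := measurableSet_Icc.prod measurableSet_Icc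
  have hae : f =ᵐ[volume.restrict (Icc a b ×ˢ Icc c d)] fun _ => 0 :=
    (setIntegral_eq_zero_iff_of_nonneg_ae ((ae_restrict_mem hm).mono h0)
      (hc.integrableOn_compact (isCompact_Icc.prod isCompact_Icc))).1
      (hi.antisymm (setIntegral_nonneg hm h0))
  refine Measure.eqOn_of_ae_eq hae hc continuousOn_const ?_
  rw [interior_prod_eq, closure_prod_eq, interior_Icc, interior_Icc, closure_Ioo hab.ne,
    closure_Ioo hcd.ne]

/-- The derivative vanishes, up to the endpoints, where a function vanishes on an interval. -/
lemma deriv_eq_zero_of_eq_zero_on_Icc {a b x : ℝ} (hab : a < b) {f : ℝ → ℝ} (hx : x ∈ Icc a b)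
    (hf : DifferentiableAt ℝ f x) (h0 : ∀ y ∈ Icc a b, f y = 0) : deriv f x = 0 := by
  have hu := uniqueDiffOn_Icc hab x hx
  rw [← hf.derivWithin hu, derivWithin_congr (fun y hy => h0 y hy) (h0 x hx)]
  simp

lemma ContinuousOn.u3_slice {T R₁ R₂ : ℝ} {u : ℝ → ℝ → ℝ → ℝ}
    (hu : ContinuousOn (u3 u) (dom3 T R₁ R₂)) {t : ℝ} (ht : t ∈ Icc 0 T) (s : Set ℝ) :
    ContinuousOn (fun z : ℝ × ℝ => u t z.1 z.2) (Icc R₁ R₂ ×ˢ s) :=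
  hu.comp (f := fun z : ℝ × ℝ => (t, z)) (by fun_prop) fun _ hz => ⟨ht, hz.1, mem_univ _⟩

/-- The local energy balance: the power density is a divergence, minus the viscous dissipation,
minus the work of gravity and stratification. -/
lemma energy_density_identity {r μ g R dR a b q π₀ at_ bt qt ar ath br bth arr atht brr btht
    πr πt : ℝ}
    (hr : r ≠ 0)
    (h1 : R * at_ = μ * (arr + 1 / r * ar + 1 / r ^ 2 * atht - a / r ^ 2 - 2 / r ^ 2 * bth)
      - πr - q * g)
    (h2 : R * bt = μ * (brr + 1 / r * br + 1 / r ^ 2 * btht - b / r ^ 2 + 2 / r ^ 2 * ath)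
      - 1 / r * πt)
    (h3 : qt = -(a * dR)) (h4 : a + r * ar + bth = 0) :
    r * (a * (R * at_) + b * (R * bt) + q * qt) =
      (μ * (a * ar + b * br) - a * π₀ +
        r * (μ * (ar * ar + a * arr + (br * br + b * brr)) - (ar * π₀ + a * πr))) +
      (μ / r * (ath * ath + a * atht + (bth * bth + b * btht)) - (bth * π₀ + b * πt)) -
      (μ * r * (ar ^ 2 + br ^ 2) + μ / r * ((ath - b) ^ 2 + (bth + a) ^ 2)) -
      r * (q * a * (g + dR)) := by
  obtain rfl : bth = -(a + r * ar) := by linarith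
  rw [h1, h2, h3]
  field_simp
  ring

lemma energy_work_le {r q a h R C : ℝ} (hr : 0 ≤ r) (h1 : |h| ≤ C) (h2 : |h| ≤ C * R) :
    -(2 * (r * (q * a * h))) ≤ C * (r * (R * a ^ 2 + q ^ 2)) := by
  have h3 : -(2 * (q * a * h)) ≤ |h| * (a ^ 2 + q ^ 2) := by
    rcases abs_cases h with ⟨e, hh⟩ | ⟨e, hh⟩ <;> rw [e]
    · nlinarith [mul_nonneg hh (sq_nonneg (a + q))]
    · nlinarith [mul_nonneg (neg_nonneg.2 hh.le) (sq_nonneg (a - q))]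
  have h4 : |h| * (a ^ 2 + q ^ 2) ≤ C * R * a ^ 2 + C * q ^ 2 := by
    nlinarith [mul_le_mul_of_nonneg_right h2 (sq_nonneg a),
      mul_le_mul_of_nonneg_right h1 (sq_nonneg q)]
  nlinarith [mul_le_mul_of_nonneg_left (h3.trans h4) hr]

/-- The energy density of a perturbation. -/
def energyDensity (ρb : ℝ → ℝ) (vr vθ ρ : ℝ → ℝ → ℝ → ℝ) (t : ℝ) (z : ℝ × ℝ) : ℝ :=
  z.1 * (ρb z.1 * (vr t z.1 z.2 ^ 2 + vθ t z.1 z.2 ^ 2) + ρ t z.1 z.2 ^ 2)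

/-- Half of the time derivative of the energy density. -/
def powerDensity (ρb : ℝ → ℝ) (vr vθ ρ : ℝ → ℝ → ℝ → ℝ) (t : ℝ) (z : ℝ × ℝ) : ℝ :=
  z.1 * (vr t z.1 z.2 * (ρb z.1 * dt3 vr t z.1 z.2) + vθ t z.1 z.2 * (ρb z.1 * dt3 vθ t z.1 z.2) +
    ρ t z.1 z.2 * dt3 ρ t z.1 z.2)

/-- The energy inequality on one angular period. -/
lemma setIntegral_powerDensity_le {R₁ R₂ μ α g T C : ℝ} (hR₁ : 0 < R₁) (hR₁₂ : R₁ < R₂)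
    (hμ : 0 < μ) (hα : 0 ≤ 1 - α * R₁ / μ) {ρb : ℝ → ℝ} (hρb : Continuous ρb)
    (hC1 : ∀ r ∈ Icc R₁ R₂, |g + deriv ρb r| ≤ C)
    (hC2 : ∀ r ∈ Icc R₁ R₂, |g + deriv ρb r| ≤ C * ρb r)
    {vr vθ ρ p : ℝ → ℝ → ℝ → ℝ}
    (hvr : Reg2 T R₁ R₂ vr) (hvθ : Reg2 T R₁ R₂ vθ)
    (hρ : Reg1 T R₁ R₂ ρ) (hp : RegP T R₁ R₂ p)
    (hper : ∀ t ∈ Icc (0:ℝ) T, ∀ r ∈ Icc R₁ R₂, ∀ θ : ℝ,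
      vr t r (θ + 2 * π) = vr t r θ ∧ vθ t r (θ + 2 * π) = vθ t r θ ∧
      ρ t r (θ + 2 * π) = ρ t r θ ∧ p t r (θ + 2 * π) = p t r θ)
    (hsol : SolvesLinOn T R₁ R₂ μ α g ρb vr vθ ρ p) {t : ℝ} (ht : t ∈ Icc 0 T) (θ₀ : ℝ) :
    ∫ z in Icc R₁ R₂ ×ˢ Icc θ₀ (θ₀ + 2 * π), 2 * powerDensity ρb vr vθ ρ t z ≤
      C * ∫ z in Icc R₁ R₂ ×ˢ Icc θ₀ (θ₀ + 2 * π), energyDensity ρb vr vθ ρ t z := by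
  obtain ⟨dvr, cvr, cvrt, cvr1, cvr2, cvr11, -, cvr22⟩ := hvr
  obtain ⟨dvθ, cvθ, cvθt, cvθ1, cvθ2, cvθ11, -, cvθ22⟩ := hvθ
  obtain ⟨dρ, cρ, cρt, -, -⟩ := hρ
  obtain ⟨dp, cp, cp1, cp2⟩ := hp
  have hpos : ∀ r ∈ Icc R₁ R₂, 0 < r := fun r hr => hR₁.trans_le hr.1
  have hper_deriv : ∀ u : ℝ → ℝ → ℝ → ℝ, ∀ r : ℝ, (∀ θ, u t r (θ + 2 * π) = u t r θ) →
      ∀ θ, dq3 u t r (θ + 2 * π) = dq3 u t r θ := by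
    intro u r hu θ
    rw [dq3, dq3, ← deriv_comp_add_const]
    exact congrArg (fun f => deriv f θ) (funext hu)
  replace cvr := cvr.u3_slice ht (Icc θ₀ (θ₀ + 2 * π))
  replace cvrt := cvrt.u3_slice ht (Icc θ₀ (θ₀ + 2 * π))
  replace cvr1 := cvr1.u3_slice ht (Icc θ₀ (θ₀ + 2 * π))
  replace cvr2 := cvr2.u3_slice ht (Icc θ₀ (θ₀ + 2 * π))
  replace cvr11 := cvr11.u3_slice ht (Icc θ₀ (θ₀ + 2 * π))
  replace cvr22 := cvr22.u3_slice ht (Icc θ₀ (θ₀ + 2 * π))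
  replace cvθ := cvθ.u3_slice ht (Icc θ₀ (θ₀ + 2 * π))
  replace cvθt := cvθt.u3_slice ht (Icc θ₀ (θ₀ + 2 * π))
  replace cvθ1 := cvθ1.u3_slice ht (Icc θ₀ (θ₀ + 2 * π))
  replace cvθ2 := cvθ2.u3_slice ht (Icc θ₀ (θ₀ + 2 * π))
  replace cvθ11 := cvθ11.u3_slice ht (Icc θ₀ (θ₀ + 2 * π))
  replace cvθ22 := cvθ22.u3_slice ht (Icc θ₀ (θ₀ + 2 * π))
  replace cρ := cρ.u3_slice ht (Icc θ₀ (θ₀ + 2 * π))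
  replace cρt := cρt.u3_slice ht (Icc θ₀ (θ₀ + 2 * π))
  replace cp := cp.u3_slice ht (Icc θ₀ (θ₀ + 2 * π))
  replace cp1 := cp1.u3_slice ht (Icc θ₀ (θ₀ + 2 * π))
  replace cp2 := cp2.u3_slice ht (Icc θ₀ (θ₀ + 2 * π))
  set K := Icc R₁ R₂ ×ˢ Icc θ₀ (θ₀ + 2 * π)
  have hK : IsCompact K := isCompact_Icc.prod isCompact_Icc
  have cinv : ContinuousOn (fun z : ℝ × ℝ => μ / z.1) K :=
    continuousOn_const.div continuousOn_fst fun z hz => (hpos z.1 hz.1).ne'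
  let F : ℝ → ℝ → ℝ := fun r θ =>
    r * (μ * (vr t r θ * dr3 vr t r θ + vθ t r θ * dr3 vθ t r θ) - vr t r θ * p t r θ)
  let F' : ℝ → ℝ → ℝ := fun r θ =>
    (μ * (vr t r θ * dr3 vr t r θ + vθ t r θ * dr3 vθ t r θ) - vr t r θ * p t r θ) +
      r * (μ * (dr3 vr t r θ * dr3 vr t r θ + vr t r θ * dr3 (dr3 vr) t r θ +
        (dr3 vθ t r θ * dr3 vθ t r θ + vθ t r θ * dr3 (dr3 vθ) t r θ)) -
        (dr3 vr t r θ * p t r θ + vr t r θ * dr3 p t r θ))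
  let G : ℝ → ℝ → ℝ := fun r θ =>
    μ / r * (vr t r θ * dq3 vr t r θ + vθ t r θ * dq3 vθ t r θ) - vθ t r θ * p t r θ
  let G' : ℝ → ℝ → ℝ := fun r θ =>
    μ / r * (dq3 vr t r θ * dq3 vr t r θ + vr t r θ * dq3 (dq3 vr) t r θ +
        (dq3 vθ t r θ * dq3 vθ t r θ + vθ t r θ * dq3 (dq3 vθ) t r θ)) -
        (dq3 vθ t r θ * p t r θ + vθ t r θ * dq3 p t r θ)
  have hF : ∀ r ∈ Icc R₁ R₂, ∀ θ ∈ Icc θ₀ (θ₀ + 2 * π),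
      HasDerivAt (fun r' => F r' θ) (F' r θ) r := by
    intro r hr θ _
    obtain ⟨-, a1, -, a11, -, -⟩ := dvr t ht r hr θ
    obtain ⟨-, b1, -, b11, -, -⟩ := dvθ t ht r hr θ
    have p1 := (dp t ht r hr θ).1
    have h := (hasDerivAt_id' r).mul ((((a1.hasDerivAt.mul a11.hasDerivAt).add
      (b1.hasDerivAt.mul b11.hasDerivAt)).const_mul μ).sub
        (a1.hasDerivAt.mul p1.hasDerivAt))
    rw [one_mul] at h
    exact h
  have hG : ∀ r ∈ Icc R₁ R₂, ∀ θ ∈ Icc θ₀ (θ₀ + 2 * π),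
      HasDerivAt (fun θ' => G r θ') (G' r θ) θ := by
    intro r hr θ _
    obtain ⟨-, -, a1, -, -, a11⟩ := dvr t ht r hr θ
    obtain ⟨-, -, b1, -, -, b11⟩ := dvθ t ht r hr θ
    have p1 := (dp t ht r hr θ).2
    exact (((a1.hasDerivAt.mul a11.hasDerivAt).add
      (b1.hasDerivAt.mul b11.hasDerivAt)).const_mul (μ / r)).sub
        (b1.hasDerivAt.mul p1.hasDerivAt)
  have cF : ContinuousOn (fun z : ℝ × ℝ => F' z.1 z.2) K := by fun_prop
  have cG : ContinuousOn (fun z : ℝ × ℝ => G' z.1 z.2) K := by fun_prop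
  have iF := cF.integrableOn_compact (μ := volume) hK
  have iG := cG.integrableOn_compact (μ := volume) hK
  have ie : IntegrableOn (energyDensity ρb vr vθ ρ t) K := by
    refine ContinuousOn.integrableOn_compact hK ?_
    unfold energyDensity
    fun_prop
  have iw : IntegrableOn (powerDensity ρb vr vθ ρ t) K := by
    refine ContinuousOn.integrableOn_compact hK ?_
    unfold powerDensity
    fun_prop
  have hFint : ∫ z in K, F' z.1 z.2 ≤ 0 := by
    rw [setIntegral_prod_deriv_fst hR₁₂.le hF cF]
    refine setIntegral_nonpos measurableSet_Icc fun θ _ => ?_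
    obtain ⟨h1, h2, h3, h4⟩ := hsol.2 t ht θ
    simp only [F, h1, h2, h3, h4]
    have : R₁ * (μ * (vθ t R₁ θ * ((1 / R₁ - α / μ) * vθ t R₁ θ))) =
        μ * ((1 - α * R₁ / μ) * vθ t R₁ θ ^ 2) := by field_simp
    have := mul_nonneg hμ.le (mul_nonneg hα (sq_nonneg (vθ t R₁ θ)))
    simp only [zero_mul, add_zero, mul_zero, sub_zero, zero_add, zero_sub]
    linarith
  have hGint : ∫ z in K, G' z.1 z.2 = 0 := by
    rw [setIntegral_prod_deriv_snd (by linarith [pi_pos]) hG cG]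
    refine setIntegral_eq_zero_of_forall_eq_zero fun r hr => ?_
    have h := hper t ht r hr
    simp only [G, (h θ₀).1, (h θ₀).2.1, (h θ₀).2.2.2, hper_deriv vr r (fun θ => (h θ).1),
      hper_deriv vθ r (fun θ => (h θ).2.1), sub_self]
  have hpt : ∀ z ∈ K, 2 * powerDensity ρb vr vθ ρ t z ≤
      2 * F' z.1 z.2 + 2 * G' z.1 z.2 + C * energyDensity ρb vr vθ ρ t z := by
    rintro ⟨r, θ⟩ ⟨hr, -⟩
    have hr0 := hpos r hr
    obtain ⟨h1, h2, h3, h4⟩ := hsol.1 t ht r hr θ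
    have h4' : vr t r θ + r * dr3 vr t r θ + dq3 vθ t r θ = 0 := by
      have hd : deriv (fun x => x * vr t x θ) r = 1 * vr t r θ + r * dr3 vr t r θ :=
        ((hasDerivAt_id' r).mul (dvr t ht r hr θ).2.1.hasDerivAt).deriv
      rw [← h4, hd, one_mul]
    have key := energy_density_identity (b := vθ t r θ) (π₀ := p t r θ) hr0.ne' h1 h2 h3 h4'
    have hw := energy_work_le (q := ρ t r θ) (a := vr t r θ) hr0.le (hC1 r hr) (hC2 r hr)
    have hCR : 0 ≤ C * ρb r := (abs_nonneg _).trans (hC2 r hr)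
    have hD : 0 ≤ μ * r * (dr3 vr t r θ ^ 2 + dr3 vθ t r θ ^ 2) +
      μ / r * ((dq3 vr t r θ - vθ t r θ) ^ 2 + (dq3 vθ t r θ + vr t r θ) ^ 2) := by positivity
    have hE := mul_nonneg hr0.le (mul_nonneg hCR (sq_nonneg (vθ t r θ)))
    simp only [powerDensity, energyDensity, F', G']
    rw [key]
    nlinarith
  have iFG : IntegrableOn (fun z : ℝ × ℝ => 2 * F' z.1 z.2 + 2 * G' z.1 z.2) K :=
    (iF.const_mul 2).add (iG.const_mul 2)
  calc ∫ z in K, 2 * powerDensity ρb vr vθ ρ t z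
      ≤ ∫ z in K, (2 * F' z.1 z.2 + 2 * G' z.1 z.2 + C * energyDensity ρb vr vθ ρ t z) :=
        setIntegral_mono_on (iw.const_mul 2)
          (iFG.add (ie.const_mul C)) hK.measurableSet hpt
    _ = 2 * (∫ z in K, F' z.1 z.2) + 2 * (∫ z in K, G' z.1 z.2) +
          C * ∫ z in K, energyDensity ρb vr vθ ρ t z := by
        rw [integral_add iFG (ie.const_mul C),
          integral_add (iF.const_mul 2) (iG.const_mul 2), integral_const_mul, integral_const_mul,
          integral_const_mul]
    _ ≤ _ := by linarith

/-- A single constant dominates the gravity and stratification coefficient. -/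
lemma exists_work_bound {R₁ R₂ g : ℝ} {ρb : ℝ → ℝ} (hρb : ContDiff ℝ (⊤ : ℕ∞) ρb)
    (hρbpos : ∀ r ∈ Icc R₁ R₂, 0 < ρb r) :
    ∃ C, ∀ r ∈ Icc R₁ R₂, |g + deriv ρb r| ≤ C ∧ |g + deriv ρb r| ≤ C * ρb r := by
  have hd : Continuous (deriv ρb) := hρb.continuous_deriv (by simp)
  have hc : Continuous ρb := hρb.continuous
  obtain ⟨C₁, h₁⟩ := (isCompact_Icc (a := R₁) (b := R₂)).exists_bound_of_continuousOn
    (f := fun r => g + deriv ρb r) (by fun_prop)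
  obtain ⟨C₂, h₂⟩ := (isCompact_Icc (a := R₁) (b := R₂)).exists_bound_of_continuousOn
    (f := fun r => (g + deriv ρb r) / ρb r)
    (ContinuousOn.div (by fun_prop) hc.continuousOn fun r hr => (hρbpos r hr).ne')
  refine ⟨max C₁ C₂, fun r hr => ⟨(h₁ r hr).trans (le_max_left _ _), ?_⟩⟩
  have h := (h₂ r hr).trans (le_max_right C₁ C₂)
  rwa [norm_div, norm_eq_abs, norm_eq_abs, abs_of_pos (hρbpos r hr),
    div_le_iff₀ (hρbpos r hr)] at h

/-- The velocity and density perturbations stay zero. -/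
lemma velocity_density_eq_zero {R₁ R₂ μ α g T : ℝ} (hR₁ : 0 < R₁) (hR₁₂ : R₁ < R₂) (hμ : 0 < μ)
    (hα : 0 ≤ 1 - α * R₁ / μ)
    {ρb : ℝ → ℝ} (hρb : ContDiff ℝ (⊤ : ℕ∞) ρb) (hρbpos : ∀ r ∈ Icc R₁ R₂, 0 < ρb r)
    {vr vθ ρ p : ℝ → ℝ → ℝ → ℝ}
    (hvr : Reg2 T R₁ R₂ vr) (hvθ : Reg2 T R₁ R₂ vθ)
    (hρ : Reg1 T R₁ R₂ ρ) (hp : RegP T R₁ R₂ p)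
    (hper : ∀ t ∈ Icc (0:ℝ) T, ∀ r ∈ Icc R₁ R₂, ∀ θ : ℝ,
      vr t r (θ + 2 * π) = vr t r θ ∧ vθ t r (θ + 2 * π) = vθ t r θ ∧
      ρ t r (θ + 2 * π) = ρ t r θ ∧ p t r (θ + 2 * π) = p t r θ)
    (hsol : SolvesLinOn T R₁ R₂ μ α g ρb vr vθ ρ p)
    (hinit : ∀ r ∈ Icc R₁ R₂, ∀ θ : ℝ, vr 0 r θ = 0 ∧ vθ 0 r θ = 0 ∧ ρ 0 r θ = 0) :
    ∀ t ∈ Icc (0:ℝ) T, ∀ r ∈ Icc R₁ R₂, ∀ θ : ℝ,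
      vr t r θ = 0 ∧ vθ t r θ = 0 ∧ ρ t r θ = 0 := by
  intro t ht r hr θ
  have hcb : Continuous ρb := hρb.continuous
  obtain ⟨C, hC⟩ := exists_work_bound (g := g) hρb hρbpos
  set K := Icc R₁ R₂ ×ˢ Icc θ (θ + 2 * π)
  have hK : IsCompact K := isCompact_Icc.prod isCompact_Icc
  have hKdom : Icc 0 T ×ˢ K ⊆ dom3 T R₁ R₂ := fun z hz => ⟨hz.1, hz.2.1, mem_univ _⟩
  have hdens : ∀ s ∈ Icc 0 T, ∀ z ∈ K, HasDerivAt (fun s => energyDensity ρb vr vθ ρ s z)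
      (2 * powerDensity ρb vr vθ ρ s z) s := by
    intro s hs z hz
    have h := (((((hvr.1 s hs z.1 hz.1 z.2).1.hasDerivAt.pow 2).add
      ((hvθ.1 s hs z.1 hz.1 z.2).1.hasDerivAt.pow 2)).const_mul (ρb z.1)).add
      ((hρ.1 s hs z.1 hz.1 z.2).1.hasDerivAt.pow 2)).const_mul z.1
    refine h.congr_deriv ?_
    simp only [powerDensity, dt3]
    push_cast
    ring
  have cvr := hvr.2.1.mono hKdom
  have cvθ := hvθ.2.1.mono hKdom
  have cρ := hρ.2.1.mono hKdom
  have cvrt := hvr.2.2.1.mono hKdom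
  have cvθt := hvθ.2.2.1.mono hKdom
  have cρt := hρ.2.2.1.mono hKdom
  unfold u3 at cvr cvθ cρ cvrt cvθt cρt
  have ce : ContinuousOn (fun z : ℝ × ℝ × ℝ => energyDensity ρb vr vθ ρ z.1 z.2)
      (Icc 0 T ×ˢ K) := by
    unfold energyDensity
    fun_prop
  have cw : ContinuousOn (fun z : ℝ × ℝ × ℝ => 2 * powerDensity ρb vr vθ ρ z.1 z.2)
      (Icc 0 T ×ˢ K) := by
    unfold powerDensity
    fun_prop
  obtain ⟨hEc, hEd⟩ := parametric_setIntegral (ν := volume) hK hdens ce cw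
  have hE0 : ∫ z in K, energyDensity ρb vr vθ ρ 0 z ≤ 0 := by
    refine (setIntegral_eq_zero_of_forall_eq_zero fun z hz => ?_).le
    obtain ⟨h1, h2, h3⟩ := hinit z.1 hz.1 z.2
    simp [energyDensity, h1, h2, h3]
  have hE := nonpos_of_deriv_le_mul hEc hEd (fun s hs =>
    setIntegral_powerDensity_le hR₁ hR₁₂ hμ hα hcb (fun r hr => (hC r hr).1)
      (fun r hr => (hC r hr).2) hvr hvθ hρ hp hper hsol (Ioo_subset_Icc_self hs) θ) hE0 ht
  have hz := eq_zero_of_setIntegral_rect_nonpos hR₁₂ (by linarith [pi_pos])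
    (ce.comp (f := fun z => (t, z)) (by fun_prop) fun z hz => ⟨ht, hz⟩)
    (fun z hz => ?_) hE (r, θ) ⟨hr, left_mem_Icc.2 (by linarith [pi_pos])⟩
  · have hr0 : 0 < r := hR₁.trans_le hr.1
    have hb := hρbpos r hr
    have hz' := (mul_eq_zero.1 hz).resolve_left hr0.ne'
    simp only at hz'
    have h3 : ρ t r θ ^ 2 = 0 := by
      nlinarith only [hz', sq_nonneg (ρ t r θ),
        mul_nonneg hb.le (add_nonneg (sq_nonneg (vr t r θ)) (sq_nonneg (vθ t r θ)))]
    rw [h3, add_zero] at hz'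
    have h12 := (mul_eq_zero.1 hz').resolve_left hb.ne'
    refine ⟨?_, ?_, ?_⟩ <;> refine pow_eq_zero_iff two_ne_zero |>.1 ?_
    · linarith [sq_nonneg (vr t r θ), sq_nonneg (vθ t r θ)]
    · linarith [sq_nonneg (vr t r θ), sq_nonneg (vθ t r θ)]
    · exact h3
  · have := hR₁.trans_le hz.1.1
    have := hρbpos z.1 hz.1
    simp only [Function.comp, energyDensity]
    positivity

/-- Uniqueness of the solution of the linearized problem (Lemma 5.1 of the paper). -/
theorem statement18 (R₁ R₂ μ α g T : ℝ) (hR₁ : 0 < R₁) (hR₁₂ : R₁ < R₂) (hμ : 0 < μ)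
    (hg : 0 < g) (hα : 0 ≤ 1 - α * R₁ / μ) (hT : 0 < T)
    (ρb : ℝ → ℝ) (hρb : ContDiff ℝ (⊤ : ℕ∞) ρb) (hρbpos : ∀ r ∈ Icc R₁ R₂, 0 < ρb r)
    (vr vθ ρ p : ℝ → ℝ → ℝ → ℝ)
    (hvr : Reg2 T R₁ R₂ vr) (hvθ : Reg2 T R₁ R₂ vθ)
    (hρ : Reg1 T R₁ R₂ ρ) (hp : RegP T R₁ R₂ p)
    (hper : ∀ t ∈ Icc (0:ℝ) T, ∀ r ∈ Icc R₁ R₂, ∀ θ : ℝ,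
      vr t r (θ + 2 * π) = vr t r θ ∧ vθ t r (θ + 2 * π) = vθ t r θ ∧
      ρ t r (θ + 2 * π) = ρ t r θ ∧ p t r (θ + 2 * π) = p t r θ)
    (hsol : SolvesLinOn T R₁ R₂ μ α g ρb vr vθ ρ p)
    (hinit : ∀ r ∈ Icc R₁ R₂, ∀ θ : ℝ, vr 0 r θ = 0 ∧ vθ 0 r θ = 0 ∧ ρ 0 r θ = 0) :
    ∀ t ∈ Icc (0:ℝ) T, ∀ r ∈ Icc R₁ R₂, ∀ θ : ℝ,
      vr t r θ = 0 ∧ vθ t r θ = 0 ∧ ρ t r θ = 0 ∧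
      dr3 p t r θ = 0 ∧ dq3 p t r θ = 0 := by
  have hz := velocity_density_eq_zero hR₁ hR₁₂ hμ hα hρb hρbpos hvr hvθ hρ hp hper hsol hinit
  have hderiv : ∀ u, Reg2 T R₁ R₂ u →
      (∀ t ∈ Icc (0:ℝ) T, ∀ r ∈ Icc R₁ R₂, ∀ θ : ℝ, u t r θ = 0) →
      ∀ t ∈ Icc (0:ℝ) T, ∀ r ∈ Icc R₁ R₂, ∀ θ : ℝ,
        dt3 u t r θ = 0 ∧ lapR u t r θ = 0 ∧ dq3 u t r θ = 0 := by
    intro u hu h0 t ht r hr θ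
    have hr1 : ∀ x ∈ Icc R₁ R₂, dr3 u t x θ = 0 := fun x hx =>
      deriv_eq_zero_of_eq_zero_on_Icc hR₁₂ hx (hu.1 t ht x hx θ).2.1 fun y hy => h0 t ht y hy θ
    have hq : ∀ θ, dq3 u t r θ = 0 := fun θ => by
      simp [dq3, funext fun θ' => h0 t ht r hr θ']
    have hrr : dr3 (dr3 u) t r θ = 0 :=
      deriv_eq_zero_of_eq_zero_on_Icc hR₁₂ hr (hu.1 t ht r hr θ).2.2.2.1 hr1
    have hqq : dq3 (dq3 u) t r θ = 0 := by
      rw [dq3, funext hq]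
      simp
    refine ⟨deriv_eq_zero_of_eq_zero_on_Icc hT ht (hu.1 t ht r hr θ).1 fun s hs => h0 s hs r hr θ,
      ?_, hq θ⟩
    simp [lapR, hrr, hqq, hr1 r hr]
  intro t ht r hr θ
  obtain ⟨h1, h2, h3⟩ := hz t ht r hr θ
  obtain ⟨a1, a2, a3⟩ := hderiv vr hvr (fun t ht r hr θ => (hz t ht r hr θ).1) t ht r hr θ
  obtain ⟨b1, b2, b3⟩ := hderiv vθ hvθ (fun t ht r hr θ => (hz t ht r hr θ).2.1) t ht r hr θ
  obtain ⟨e1, e2, -, -⟩ := hsol.1 t ht r hr θ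
  have hr0 : 0 < r := hR₁.trans_le hr.1
  simp only [a1, a2, a3, b1, b2, b3, h1, h2, h3] at e1 e2
  refine ⟨h1, h2, h3, by simpa using e1.symm, ?_⟩
  simpa [hr0.ne'] using e2.symm

end
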